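/- Lemma 3(i): Under Assumption 2, the matrix Ψ = (I − ΞW)⁻¹(I − Ξ) satisfies Ψ i i > 0 for every stubborn agent i (i.e., every i with ξᵢ < 1). -/

import Mathlib

open Matrix Filter Finset

/-- `S` is an independent strongly connected component of the influence graph `G(W)`
(edge from `j` to `i` iff `W i j ≠ 0`): nonempty, in-closed and strongly connected. -/
def IsISCC {n : ℕ} (W : Matrix (Fin n) (Fin n) ℝ) (S : Set (Fin n)) : Prop :=
  S.Nonempty ∧ (∀ i ∈ S, ∀ j, W i j ≠ 0 → j ∈ S) ∧
    (∀ i ∈ S, ∀ j ∈ S, i ≠ j → ∃ m, 1 ≤ m ∧ 0 < (W ^ m) i j)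

/-- Assumption 2: every ISCC of `G(W)` contains at least one stubborn agent. -/
def Assumption2 {n : ℕ} (W : Matrix (Fin n) (Fin n) ℝ) (ξ : Fin n → ℝ) : Prop :=
  ∀ S : Set (Fin n), IsISCC W S → ∃ i ∈ S, ξ i < 1

/-- An in-closed nonempty set contains an independent strongly connected component. -/
theorem exists_isISCC_subset {n : ℕ} {W : Matrix (Fin n) (Fin n) ℝ}
    (hW0 : ∀ i j, 0 ≤ W i j) (hW1 : ∀ i, ∑ j, W i j = 1) {S : Set (Fin n)}
    (hS : S.Nonempty) (hcl : ∀ i ∈ S, ∀ j, W i j ≠ 0 → j ∈ S) :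
    ∃ T ⊆ S, IsISCC W T := by
  obtain ⟨T, hTS, hT⟩ := exists_minimal_le_of_wellFoundedLT
    (fun T : Set (Fin n) => T.Nonempty ∧ ∀ i ∈ T, ∀ j, W i j ≠ 0 → j ∈ T) S ⟨hS, hcl⟩
  refine ⟨T, hTS, hT.prop.1, hT.prop.2, fun i hi j hj _ => ?_⟩
  have hpow : ∀ m i j, 0 ≤ (W ^ m) i j := by
    intro m
    induction m with
    | zero => intro i j; rw [pow_zero, Matrix.one_apply]; split_ifs <;> norm_num
    | succ m ih =>
      intro i j
      rw [pow_succ, Matrix.mul_apply]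
      exact Finset.sum_nonneg fun k _ => mul_nonneg (ih i k) (hW0 k j)
  have hle : T ⊆ {k | k ∈ T ∧ ∃ m, 1 ≤ m ∧ 0 < (W ^ m) i k} := by
    refine hT.le_of_le ⟨?_, ?_⟩ fun k hk => hk.1
    · obtain ⟨k, -, hk⟩ := Finset.exists_ne_zero_of_sum_ne_zero
        (show ∑ j, W i j ≠ 0 by rw [hW1]; exact one_ne_zero)
      exact ⟨k, hT.prop.2 i hi k hk, 1, le_rfl, by
        rw [pow_one]; exact (hW0 i k).lt_of_ne' hk⟩
    · rintro k ⟨hk, m, -, hm⟩ l hl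
      refine ⟨hT.prop.2 k hk l hl, m + 1, by omega, ?_⟩
      rw [pow_succ, Matrix.mul_apply]
      exact Finset.sum_pos' (fun k _ => mul_nonneg (hpow m i k) (hW0 k l))
        ⟨k, Finset.mem_univ k, mul_pos hm ((hW0 k l).lt_of_ne' hl)⟩
  exact (hle hj).2

/-- Minimum principle: under Assumption 2, a vector `x` with `x ≥ Ξ W x` is nonnegative. -/
theorem nonneg_of_mul_sum_le {n : ℕ} {W : Matrix (Fin n) (Fin n) ℝ} {ξ : Fin n → ℝ}
    (hW0 : ∀ i j, 0 ≤ W i j) (hW1 : ∀ i, ∑ j, W i j = 1)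
    (hξ : ∀ i, 0 ≤ ξ i ∧ ξ i ≤ 1) (hA2 : Assumption2 W ξ) {x : Fin n → ℝ}
    (hx : ∀ i, ξ i * ∑ j, W i j * x j ≤ x i) (i : Fin n) : 0 ≤ x i := by
  have : Nonempty (Fin n) := ⟨i⟩
  obtain ⟨p, hp⟩ := Finite.exists_min x
  refine le_trans ?_ (hp i)
  by_contra! hneg
  have havg : ∀ k, x p ≤ ∑ j, W k j * x j := fun k => calc
    x p = ∑ j, W k j * x p := by rw [← Finset.sum_mul, hW1, one_mul]
    _ ≤ ∑ j, W k j * x j :=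
      Finset.sum_le_sum fun j _ => mul_le_mul_of_nonneg_left (hp j) (hW0 k j)
  have hone : ∀ k, x k = x p → ξ k = 1 := by
    intro k hk
    have h1 := mul_le_mul_of_nonneg_left (havg k) (hξ k).1
    have h2 := hx k
    have h3 := (hξ k).2
    nlinarith
  obtain ⟨T, hTS, hT⟩ := exists_isISCC_subset hW0 hW1 (S := {k | x k = x p}) ⟨p, rfl⟩ (by
    intro k (hk : x k = x p) j hj
    have hsum : ∑ j, W k j * (x j - x p) ≤ 0 := by
      have h := hx k
      rw [hone k hk, one_mul, hk] at h
      simp only [mul_sub, Finset.sum_sub_distrib, ← Finset.sum_mul, hW1, one_mul]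
      linarith
    have hnn : ∀ j ∈ Finset.univ, 0 ≤ W k j * (x j - x p) := fun j _ =>
      mul_nonneg (hW0 k j) (sub_nonneg.2 (hp j))
    have h0 := (Finset.sum_eq_zero_iff_of_nonneg hnn).1
      (le_antisymm hsum (Finset.sum_nonneg hnn)) j (Finset.mem_univ j)
    exact sub_eq_zero.1 ((mul_eq_zero.1 h0).resolve_left hj))
  obtain ⟨k, hk, hlt⟩ := hA2 T hT
  exact hlt.ne (hone k (hTS hk))

/-- Under Assumption 2 the matrix `I - ΞW` is invertible. -/
theorem isUnit_one_sub_diagonal_mul {n : ℕ} {W : Matrix (Fin n) (Fin n) ℝ} {ξ : Fin n → ℝ}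
    (hW0 : ∀ i j, 0 ≤ W i j) (hW1 : ∀ i, ∑ j, W i j = 1)
    (hξ : ∀ i, 0 ≤ ξ i ∧ ξ i ≤ 1) (hA2 : Assumption2 W ξ) :
    IsUnit (1 - Matrix.diagonal ξ * W) := by
  rw [Matrix.isUnit_iff_isUnit_det, isUnit_iff_ne_zero]
  intro hdet
  obtain ⟨v, hv, hmul⟩ := Matrix.exists_mulVec_eq_zero_iff.2 hdet
  have heq : ∀ i, v i = ξ i * ∑ j, W i j * v j := by
    intro i
    have h := congrFun hmul i
    rw [Matrix.sub_mulVec, Matrix.one_mulVec, ← Matrix.mulVec_mulVec, Pi.sub_apply,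
      Matrix.mulVec_diagonal, Pi.zero_apply, sub_eq_zero] at h
    exact h
  refine hv (funext fun i => le_antisymm ?_ ?_)
  · refine neg_nonneg.1 (nonneg_of_mul_sum_le hW0 hW1 hξ hA2 (x := fun i => -v i) ?_ i)
    intro i
    simp only [mul_neg, Finset.sum_neg_distrib]
    exact neg_le_neg (heq i).le
  · exact nonneg_of_mul_sum_le hW0 hW1 hξ hA2 (fun i => (heq i).ge) i

/-- Lemma 3(i): under Assumption 2, `Ψ = (I - ΞW)⁻¹ (I - Ξ)` has a positive diagonal
entry at every stubborn agent. -/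
theorem psi_diag_pos_of_stubborn
    (n : ℕ) (hn : 1 ≤ n)
    (W Ξ : Matrix (Fin n) (Fin n) ℝ) (ξ : Fin n → ℝ)
    (hW0 : ∀ i j, 0 ≤ W i j) (hW1 : ∀ i, ∑ j, W i j = 1)
    (hΞ : Ξ = Matrix.diagonal ξ) (hξ : ∀ i, 0 ≤ ξ i ∧ ξ i ≤ 1)
    (hA2 : Assumption2 W ξ)
    (Ψ : Matrix (Fin n) (Fin n) ℝ) (hΨ : Ψ = (1 - Ξ * W)⁻¹ * (1 - Ξ)) :
    ∀ i, ξ i < 1 → 0 < Ψ i i := by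
  subst hΞ
  intro i hi
  have hU := (Matrix.isUnit_iff_isUnit_det _).1 (isUnit_one_sub_diagonal_mul hW0 hW1 hξ hA2)
  have hmul : (1 - Matrix.diagonal ξ * W) * Ψ = 1 - Matrix.diagonal ξ := by
    rw [hΨ, Matrix.mul_nonsing_inv_cancel_left _ _ hU]
  have heq : ∀ k, Ψ k i =
      ξ k * ∑ j, W k j * Ψ j i + (1 - Matrix.diagonal ξ : Matrix (Fin n) (Fin n) ℝ) k i := by
    intro k
    rw [← hmul, sub_mul, one_mul, mul_assoc, Matrix.sub_apply, Matrix.diagonal_mul,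
      Matrix.mul_apply]
    ring
  have hnn : ∀ k, 0 ≤ Ψ k i := by
    refine nonneg_of_mul_sum_le hW0 hW1 hξ hA2 fun k => ?_
    rw [heq k, le_add_iff_nonneg_right, Matrix.sub_apply, Matrix.one_apply,
      Matrix.diagonal_apply]
    split_ifs
    · exact sub_nonneg.2 (hξ k).2
    · simp
  have hsum : 0 ≤ ξ i * ∑ j, W i j * Ψ j i :=
    mul_nonneg (hξ i).1 (Finset.sum_nonneg fun j _ => mul_nonneg (hW0 i j) (hnn j))
  rw [heq i, Matrix.sub_apply, Matrix.one_apply_eq, Matrix.diagonal_apply_eq]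
  linarith
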